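/- arXiv:2411.01054 — 7 statements merged into one kernel-verified Lean document; each statement's English description precedes it below -/
import Mathlib

section
/- Let H be a finite group with at least two elements acting freely on a nonempty connected topological space X, with each element of H acting as a continuous map. Then for every continuous map f : X → ℝ there exist a point x ∈ X and elements h₁ ≠ h₂ of H such that f(h₁ • x) = f(h₂ • x). (Equivalently, the Borsuk–Ulam property holds for every triple (X, τ_H, ℝ), in particular for every triple (Γ, τ_{ℤₙ}, I) with Γ a connected graph.) -/
/-- For a finite group `H` with at least two elements acting freely and
continuously on a nonempty connected topological space `X`, every continuous map
`f : X → ℝ` has an orbit coincidence: there are `x` and `h₁ ≠ h₂` with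
`f (h₁ • x) = f (h₂ • x)`. -/
theorem borsukUlam_real_of_free_action
    {H X : Type*} [Group H] [Fintype H] (hcard : 1 < Fintype.card H)
    [TopologicalSpace X] [Nonempty X] [ConnectedSpace X] [MulAction H X]
    (hcont : ∀ h : H, Continuous fun x : X => h • x)
    (hfree : ∀ (h : H) (x : X), h • x = x → h = 1)
    (f : X → ℝ) (hf : Continuous f) :
    ∃ (x : X) (h₁ h₂ : H), h₁ ≠ h₂ ∧ f (h₁ • x) = f (h₂ • x) := by
  haveI : Nontrivial H := Fintype.one_lt_card_iff_nontrivial.mp hcard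
  obtain ⟨g, hg⟩ := exists_ne (1 : H)
  obtain ⟨x₀⟩ := ‹Nonempty X›
  obtain ⟨a, ha⟩ := Finite.exists_max (fun h : H => f (h • x₀))
  obtain ⟨b, hb⟩ := Finite.exists_min (fun h : H => f (h • x₀))
  have h1 : f (g • (a • x₀)) ≤ f (a • x₀) := by
    rw [smul_smul]; exact ha (g * a)
  have h2 : f (b • x₀) ≤ f (g • (b • x₀)) := by
    rw [smul_smul]; exact hb (g * b)
  obtain ⟨x, hx⟩ := intermediate_value_univ₂ (hf.comp (hcont g)) hf h1 h2
  exact ⟨x, g, 1, hg, by rw [one_smul]; exact hx⟩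
end

section
/- Let n ≥ 1 and let C be the subspace of the product space (Fin n → ℝ) consisting of injective tuples (the ordered configuration space of n points in ℝ). If f ∈ C and σ is a permutation of Fin n such that f and f ∘ σ are joined by a path inside C, then σ is the identity permutation. -/
/-- In the ordered configuration space of `n` points in `ℝ` (the space of
injective tuples `Fin n → ℝ`), if an injective tuple `f` is joined by a path inside the
configuration space to `f ∘ σ` for a permutation `σ`, then `σ` is the identity. -/
theorem perm_eq_one_of_joinedIn_configurationSpace
    (n : ℕ) (hn : 1 ≤ n) (f : Fin n → ℝ) (hf : Function.Injective f)
    (σ : Equiv.Perm (Fin n))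
    (h : JoinedIn {g : Fin n → ℝ | Function.Injective g} f (f ∘ σ)) :
    σ = 1 := by
  obtain ⟨γ, hγ⟩ := h
  have key : ∀ i j, f i < f j → f (σ i) < f (σ j) := by
    intro i j hij
    by_contra hcon
    have hc : Continuous (fun t => γ t j - γ t i) :=
      ((continuous_apply j).comp γ.continuous).sub ((continuous_apply i).comp γ.continuous)
    obtain ⟨t, ht⟩ := mem_range_of_exists_le_of_exists_ge (c := (0 : ℝ)) hc
      ⟨1, by simp only [γ.target, Function.comp]; linarith⟩
      ⟨0, by simp only [γ.source]; linarith⟩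
    have hji : j = i := hγ t (sub_eq_zero.mp ht)
    subst hji
    exact lt_irrefl _ hij
  have hpow : ∀ i, (σ ^ orderOf σ) i = i := fun i => by rw [pow_orderOf_eq_one]; rfl
  have hpos : 0 < orderOf σ := orderOf_pos σ
  ext i
  rw [Equiv.Perm.one_apply]
  congr 1
  by_contra hne
  have hstep : ∀ k : ℕ, (σ ^ (k + 1)) i = σ ((σ ^ k) i) := fun k => by
    rw [pow_succ', Equiv.Perm.mul_apply]
  rcases lt_or_gt_of_ne (fun h => hne (hf h) : f (σ i) ≠ f i) with hlt | hlt
  · have hm : StrictAnti (fun k : ℕ => f ((σ ^ k) i)) := by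
      refine strictAnti_nat_of_succ_lt fun k => ?_
      induction k with
      | zero => simpa using hlt
      | succ k ih =>
        have := key _ _ ih
        rwa [← hstep, ← hstep] at this
    have := hm hpos
    simp [hpow] at this
  · have hm : StrictMono (fun k : ℕ => f ((σ ^ k) i)) := by
      refine strictMono_nat_of_lt_succ fun k => ?_
      induction k with
      | zero => simpa using hlt
      | succ k ih =>
        have := key _ _ ih
        rwa [← hstep, ← hstep] at this
    have := hm hpos
    simp [hpow] at this
end

section
/- Let G be a group acting on topological spaces X₁ and X₂ with each group element acting continuously, and let Y be a topological space. Suppose h : X₁ → X₂ and k : X₂ → X₁ are continuous G-equivariant maps (h(g • x) = g • h(x) and k(g • y) = g • k(y) for all g, x, y) such that h ∘ k is homotopic to the identity of X₂ and k ∘ h is homotopic to the identity of X₁. Then for every continuous f : X₂ → Y, the homotopy class of f ∘ h satisfies the Borsuk–Ulam property with respect to the G-action on X₁ if and only if the homotopy class of f satisfies the Borsuk–Ulam property with respect to the G-action on X₂. -/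
/-- The Borsuk–Ulam property is invariant under `G`-equivariant homotopy
equivalences. If `h : X₁ → X₂` and `k : X₂ → X₁` are continuous `G`-equivariant maps which
are homotopy inverse to each other, then for any continuous `f : X₂ → Y`, the class of
`f ∘ h` has the Borsuk–Ulam property (every homotopic map admits an orbit coincidence)
iff the class of `f` does. -/
theorem borsukUlam_invariant_under_equivariant_homotopy_equivalence
    {G X₁ X₂ Y : Type*} [Group G]
    [TopologicalSpace X₁] [TopologicalSpace X₂] [TopologicalSpace Y]
    [MulAction G X₁] [MulAction G X₂]
    (hc₁ : ∀ g : G, Continuous fun x : X₁ => g • x)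
    (hc₂ : ∀ g : G, Continuous fun x : X₂ => g • x)
    (h : C(X₁, X₂)) (k : C(X₂, X₁))
    (heq : ∀ (g : G) (x : X₁), h (g • x) = g • h x)
    (keq : ∀ (g : G) (y : X₂), k (g • y) = g • k y)
    (hhk : (h.comp k).Homotopic (ContinuousMap.id X₂))
    (hkh : (k.comp h).Homotopic (ContinuousMap.id X₁))
    (f : C(X₂, Y)) :
    ((∀ u : C(X₁, Y), (f.comp h).Homotopic u →
        ∃ (x : X₁) (g₁ g₂ : G), g₁ ≠ g₂ ∧ u (g₁ • x) = u (g₂ • x)) ↔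
      (∀ v : C(X₂, Y), f.Homotopic v →
        ∃ (y : X₂) (g₁ g₂ : G), g₁ ≠ g₂ ∧ v (g₁ • y) = v (g₂ • y))) := by
  constructor
  · intro H v hv
    obtain ⟨x, g₁, g₂, hne, he⟩ := H (v.comp h) (hv.comp (.refl h))
    refine ⟨h x, g₁, g₂, hne, ?_⟩
    simpa only [ContinuousMap.comp_apply, heq] using he
  · intro H u hu
    have h1 : (f.comp (h.comp k)).Homotopic (u.comp k) := hu.comp (.refl k)
    have h2 : (f.comp (h.comp k)).Homotopic f := (ContinuousMap.Homotopic.refl f).comp hhk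
    obtain ⟨y, g₁, g₂, hne, he⟩ := H (u.comp k) (h2.symm.trans h1)
    refine ⟨k y, g₁, g₂, hne, ?_⟩
    simpa only [ContinuousMap.comp_apply, keq] using he
end

section
/- Let r ≥ 1 and n ≥ 1, and let θ : F(r) → ℤₙ be a surjective group homomorphism from the free group of rank r to the cyclic group of order n. Then there exists a free basis {y₁, …, y_r} of F(r) such that θ(y₁) is a generator of ℤₙ and θ(y_i) is the neutral element for all i with 1 < i ≤ r. -/
theorem transv_exists {ι : Type} [DecidableEq ι] (i j : ι) (h : i ≠ j) :
    ∃ T : FreeGroup ι ≃* FreeGroup ι,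
      T (FreeGroup.of j) = FreeGroup.of j * (FreeGroup.of i)⁻¹ ∧
      ∀ k, k ≠ j → T (FreeGroup.of k) = FreeGroup.of k := by
  refine ⟨MonoidHom.toMulEquiv
    (FreeGroup.lift (Function.update FreeGroup.of j (FreeGroup.of j * (FreeGroup.of i)⁻¹)))
    (FreeGroup.lift (Function.update FreeGroup.of j (FreeGroup.of j * (FreeGroup.of i))))
    ?_ ?_, ?_, ?_⟩
  · apply FreeGroup.ext_hom
    intro k
    by_cases hk : k = j
    · subst hk; simp [h]
    · simp [hk]
  · apply FreeGroup.ext_hom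
    intro k
    by_cases hk : k = j
    · subst hk; simp [h]
    · simp [hk]
  · simp
  · intro k hk
    simp [hk]

theorem adapted_aux (r n : ℕ) (hr : 1 ≤ r)
    (θ : FreeGroup (Fin r) →* Multiplicative (ZMod n)) (N : ℕ) :
    ∀ (b : FreeGroupBasis (Fin r) (FreeGroup (Fin r))) (a : Fin r → ℕ),
      (∑ i, a i = N) → (∀ i, θ (b i) = Multiplicative.ofAdd (a i : ZMod n)) →
      ∃ (y : FreeGroupBasis (Fin r) (FreeGroup (Fin r))) (i₀ : Fin r),
        ∀ i, i ≠ i₀ → θ (y i) = 1 := by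
  induction N using Nat.strong_induction_on with
  | _ N ih =>
  intro b a hN hb
  by_cases hex : ∃ i j, i ≠ j ∧ 0 < a i ∧ a i ≤ a j
  · obtain ⟨i, j, hij, hi, hle⟩ := hex
    obtain ⟨T, hTj, hT⟩ := transv_exists i j hij
    have hlt : ∑ k, Function.update a j (a j - a i) k < N := by
      rw [← hN]
      apply Finset.sum_lt_sum
      · intro k _
        by_cases hk : k = j
        · subst hk; simp
        · simp [hk]
      · exact ⟨j, Finset.mem_univ _, by simp; omega⟩
    refine ih _ hlt (FreeGroupBasis.ofRepr (b.repr.trans T.symm))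
      (Function.update a j (a j - a i)) rfl ?_
    intro k
    change θ (b.repr.symm (T (FreeGroup.of k))) = _
    have hb' : ∀ k, θ (b.repr.symm (FreeGroup.of k)) = Multiplicative.ofAdd (a k : ZMod n) := hb
    by_cases hk : k = j
    · subst hk
      rw [hTj, map_mul, map_inv, map_mul, map_inv, hb', hb']
      simp [Nat.cast_sub hle, ← ofAdd_neg, ← ofAdd_add, sub_eq_add_neg]
    · rw [hT k hk, hb']
      simp [hk]
  · push Not at hex
    by_cases h0 : ∃ i, 0 < a i
    · obtain ⟨i, hi⟩ := h0
      refine ⟨b, i, fun k hk => ?_⟩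
      have h1 := hex i k (Ne.symm hk) hi
      have h2 := hex k i hk
      have : a k = 0 := by
        by_contra hne
        have := h2 (by omega)
        omega
      rw [hb, this]; simp
    · push Not at h0
      refine ⟨b, ⟨0, hr⟩, fun k _ => ?_⟩
      have : a k = 0 := by have := h0 k; omega
      rw [hb, this]; simp

/-- For every surjective homomorphism `θ` from the free group of rank `r ≥ 1`
onto the cyclic group `ℤₙ` (`n ≥ 1`), there is a free basis `y` of the free group such that
`θ (y 0)` generates `ℤₙ` and `θ (y i) = 1` for every other basis element. -/
theorem exists_basis_adapted_to_surjection_onto_zmod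
    (r n : ℕ) (hr : 1 ≤ r) (hn : 1 ≤ n)
    (θ : FreeGroup (Fin r) →* Multiplicative (ZMod n))
    (hθ : Function.Surjective θ) :
    ∃ y : FreeGroupBasis (Fin r) (FreeGroup (Fin r)),
      Subgroup.zpowers (θ (y ⟨0, hr⟩)) = ⊤ ∧
        ∀ i : Fin r, i ≠ ⟨0, hr⟩ → θ (y i) = 1 := by
  have : NeZero n := ⟨by omega⟩
  obtain ⟨b, i₀, hb⟩ := adapted_aux r n hr θ _ (FreeGroupBasis.ofFreeGroup (Fin r))
    (fun i => (Multiplicative.toAdd (θ (FreeGroup.of i))).val) rfl (by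
      intro i
      simp)
  have hy : ∀ i : Fin r, i ≠ ⟨0, hr⟩ → θ (b.reindex (Equiv.swap i₀ ⟨0, hr⟩) i) = 1 := by
    intro i hi
    rw [FreeGroupBasis.reindex_apply]
    apply hb
    intro h
    apply hi
    rw [Equiv.symm_apply_eq] at h
    simpa using h
  generalize b.reindex (Equiv.swap i₀ ⟨0, hr⟩) = y at hy
  refine ⟨y, ?_, hy⟩
  rw [eq_top_iff]
  rintro x -
  obtain ⟨g, rfl⟩ := hθ x
  obtain ⟨w, rfl⟩ := y.repr.symm.surjective g
  induction w using FreeGroup.induction_on with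
  | C1 => simp
  | of i =>
    by_cases hi : i = ⟨0, hr⟩
    · subst hi; exact Subgroup.mem_zpowers _
    · have : θ (y.repr.symm (FreeGroup.of i)) = 1 := hy i hi
      rw [this]; exact one_mem _
  | inv_of i h => rw [map_inv, map_inv]; exact inv_mem h
  | mul a b ha hb => rw [map_mul, map_mul]; exact mul_mem ha hb
end

section
/- Let r ≥ 1 and n ≥ 1, let θ : F(r) → ℤₙ be a surjective group homomorphism from the free group of rank r to the cyclic group of order n, and let {y₁, …, y_r} be a free basis of F(r) such that θ(y₁) generates ℤₙ and θ(y_j) = 1 for 1 < j ≤ r. Then the family consisting of y₁ⁿ together with the elements y₁^i · y_j · y₁^{−i} for i = 0, 1, …, n−1 and j = 2, …, r is a free basis of the kernel of θ; in particular the kernel is a free group of rank n(r−1) + 1. -/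
namespace KB

variable {J : Type*} {m : ℕ}

abbrev L (m : ℕ) (J : Type*) := FreeGroup (Unit ⊕ Fin (m + 1) × J)

def tt : L m J := FreeGroup.of (Sum.inl ())

/-- action of the inverse of the first basis element -/
def sig : Equiv.Perm (Fin (m + 1) × L m J) where
  toFun a := if h : a.1.1 < m then (⟨a.1.1 + 1, by omega⟩, a.2) else (⟨0, by omega⟩, tt⁻¹ * a.2)
  invFun a := if a.1.1 = 0 then (⟨m, by omega⟩, tt * a.2) else (⟨a.1.1 - 1, by omega⟩, a.2)
  left_inv := by
    rintro ⟨⟨k, hk⟩, w⟩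
    by_cases h : k < m
    · simp [h]
    · have : k = m := by omega
      simp [this]
  right_inv := by
    rintro ⟨⟨k, hk⟩, w⟩
    by_cases h : k = 0
    · simp [h]
    · have h1 : k - 1 < m := by omega
      have h2 : k - 1 + 1 = k := by omega
      simp [h, h1, h2]

def ee (j : J) : Equiv.Perm (Fin (m + 1) × L m J) where
  toFun a := (a.1, FreeGroup.of (Sum.inr (a.1, j)) * a.2)
  invFun a := (a.1, (FreeGroup.of (Sum.inr (a.1, j)))⁻¹ * a.2)
  left_inv := by rintro ⟨k, w⟩; simp
  right_inv := by rintro ⟨k, w⟩; simp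

lemma sig_pow (i : ℕ) (hi : i < m + 1) (v : L m J) :
    (sig ^ i) (⟨0, by omega⟩, v) = (⟨i, hi⟩, v) := by
  induction i with
  | zero => rfl
  | succ i ih =>
    rw [pow_succ', Equiv.Perm.mul_apply, ih (by omega)]
    have : i < m := by omega
    simp [sig, this]

lemma sig_pow_n (v : L m J) :
    (sig ^ (m + 1)) (⟨0, by omega⟩, v) = (⟨0, by omega⟩, tt⁻¹ * v) := by
  rw [pow_succ', Equiv.Perm.mul_apply, sig_pow m (by omega)]
  simp [sig]

variable {I G : Type*} [Group G]

def phi (y : I → G) (i0 : I) : L m {j : I // j ≠ i0} →* G :=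
  FreeGroup.lift (Sum.elim (fun _ => y i0 ^ (m + 1))
    (fun p => y i0 ^ (p.1 : ℕ) * y p.2.1 * (y i0 ^ (p.1 : ℕ))⁻¹))

open Classical in
noncomputable def rho (y : FreeGroupBasis I G) (i0 : I) :
    G →* Equiv.Perm (Fin (m + 1) × L m {j : I // j ≠ i0}) :=
  y.lift (fun j => if h : j = i0 then sig⁻¹ else ee ⟨j, h⟩)

lemma rho_zero (y : FreeGroupBasis I G) (i0 : I) : rho (m := m) y i0 (y i0) = sig⁻¹ := by
  simp [rho]

lemma rho_ne (y : FreeGroupBasis I G) (i0 : I) (j : {j : I // j ≠ i0}) :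
    rho (m := m) y i0 (y j.1) = ee j := by
  simp [rho, j.2]

def pp (y : I → G) (i0 : I) (a : Fin (m + 1) × L m {j : I // j ≠ i0}) : G :=
  (y i0 ^ (a.1 : ℕ))⁻¹ * phi y i0 a.2

lemma pp_sig (y : I → G) (i0 : I) (a : Fin (m + 1) × L m {j : I // j ≠ i0}) :
    pp y i0 (sig a) = (y i0)⁻¹ * pp y i0 a := by
  obtain ⟨⟨k, hk⟩, w⟩ := a
  by_cases h : k < m
  · simp [sig, h, pp, pow_succ, mul_assoc]
  · have : k = m := by omega
    subst this
    simp [sig, pp, phi, tt, pow_succ, mul_assoc]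

lemma pp_ee (y : I → G) (i0 : I) (j) (a : Fin (m + 1) × L m {j : I // j ≠ i0}) :
    pp y i0 (ee j a) = y j.1 * pp y i0 a := by
  obtain ⟨k, w⟩ := a
  simp [ee, pp, phi, mul_assoc]

lemma pp_rho (y : FreeGroupBasis I G) (i0 : I) (g : G) :
    ∀ a, pp (m := m) y i0 (rho y i0 g a) = g * pp y i0 a := by
  obtain ⟨g, rfl⟩ := y.repr.symm.surjective g
  induction g using FreeGroup.induction_on with
  | C1 => simp
  | of j =>
    intro a
    change pp y i0 (rho y i0 (y j) a) = y j * _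
    by_cases h : j = i0
    · subst h
      rw [rho_zero]
      have := pp_sig y j (sig⁻¹ a)
      rw [← Equiv.Perm.mul_apply, mul_inv_cancel, Equiv.Perm.one_apply] at this
      rw [this]; simp
    · rw [rho_ne y i0 ⟨j, h⟩, pp_ee]
  | inv_of j ih =>
    intro a
    have := ih ((rho y i0 (y.repr.symm (FreeGroup.of j)))⁻¹ a)
    rw [← Equiv.Perm.mul_apply, mul_inv_cancel, Equiv.Perm.one_apply] at this
    rw [map_inv, map_inv, this]; simp
  | mul x y hx hy =>
    intro a
    rw [map_mul, map_mul, Equiv.Perm.mul_apply, hx, hy, mul_assoc]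

lemma rho_phi (y : FreeGroupBasis I G) (i0 : I) (w : L m {j : I // j ≠ i0}) :
    ∀ v, rho (m := m) y i0 (phi y i0 w) (⟨0, by omega⟩, v) = (⟨0, by omega⟩, w * v) := by
  induction w using FreeGroup.induction_on with
  | C1 => simp
  | of j =>
    intro v
    rcases j with u | ⟨i, j⟩
    · simp only [phi, FreeGroup.lift_apply_of, Sum.elim_inl, map_pow, rho_zero, inv_pow]
      rw [Equiv.Perm.inv_eq_iff_eq, sig_pow_n]
      simp [tt]
    · simp only [phi, FreeGroup.lift_apply_of, Sum.elim_inr, map_mul, map_inv, map_pow, rho_zero,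
        inv_pow, inv_inv, Equiv.Perm.mul_apply, rho_ne]
      rw [Equiv.Perm.inv_eq_iff_eq, sig_pow i.1 i.2, sig_pow i.1 i.2]
      rfl
  | inv_of j ih =>
    intro v
    rw [map_inv, map_inv, Equiv.Perm.inv_eq_iff_eq, ih]
    simp
  | mul x y hx hy =>
    intro a
    rw [map_mul, map_mul, Equiv.Perm.mul_apply, hy, hx, mul_assoc]

lemma phi_injective (y : FreeGroupBasis I G) (i0 : I) :
    Function.Injective (phi (m := m) y i0) := by
  intro a b h
  have ha := rho_phi y i0 a 1
  rw [h, rho_phi y i0 b 1] at ha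
  simpa using ha.symm

lemma phi_range (y : FreeGroupBasis I G) (i0 : I) (g : G) :
    ∃ k : ℕ, k < m + 1 ∧ ∃ w, g = (y i0 ^ k)⁻¹ * phi (m := m) y i0 w := by
  have := pp_rho (m := m) y i0 g (⟨0, by omega⟩, 1)
  refine ⟨(rho (m := m) y i0 g (⟨0, by omega⟩, 1)).1, Fin.is_lt _,
    (rho (m := m) y i0 g (⟨0, by omega⟩, 1)).2, ?_⟩
  simpa [pp] using this.symm

end KB

/-- Let `θ : F(r) → ℤₙ` be surjective and let `y` be a free basis of `F(r)` with
`θ (y 0)` a generator and `θ (y j) = 1` for `j ≠ 0`. Then the kernel of `θ` has a free basis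
consisting of `(y 0) ^ n` together with the elements `(y 0)^i * (y j) * (y 0)^(-i)` for
`0 ≤ i ≤ n - 1` and `j ≠ 0`; in particular the kernel is free of rank `n (r - 1) + 1`. -/
theorem kernel_basis_of_adapted_basis
    (r n : ℕ) (hr : 1 ≤ r) (hn : 1 ≤ n)
    (θ : FreeGroup (Fin r) →* Multiplicative (ZMod n))
    (hθ : Function.Surjective θ)
    (y : FreeGroupBasis (Fin r) (FreeGroup (Fin r)))
    (hgen : Subgroup.zpowers (θ (y ⟨0, hr⟩)) = ⊤)
    (htriv : ∀ j : Fin r, j ≠ ⟨0, hr⟩ → θ (y j) = 1) :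
    ∃ c : FreeGroupBasis (Unit ⊕ Fin n × {j : Fin r // j ≠ ⟨0, hr⟩}) θ.ker,
      ((c (Sum.inl ()) : FreeGroup (Fin r)) = (y ⟨0, hr⟩) ^ n) ∧
        ∀ (i : Fin n) (j : {j : Fin r // j ≠ ⟨0, hr⟩}),
          (c (Sum.inr (i, j)) : FreeGroup (Fin r)) =
            (y ⟨0, hr⟩) ^ (i : ℕ) * y j.1 * ((y ⟨0, hr⟩) ^ (i : ℕ))⁻¹ := by
  obtain ⟨m, rfl⟩ : ∃ m, n = m + 1 := ⟨n - 1, by omega⟩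
  have hord : orderOf (θ (y ⟨0, hr⟩)) = m + 1 := by
    rw [← Nat.card_zpowers, hgen, Subgroup.card_top]
    simp
  have hpow : θ (y ⟨0, hr⟩) ^ (m + 1) = 1 := orderOf_dvd_iff_pow_eq_one.1 hord.dvd
  have hker : ∀ w, KB.phi (m := m) y ⟨0, hr⟩ w ∈ θ.ker := by
    intro w
    have : θ.comp (KB.phi (m := m) y ⟨0, hr⟩) = 1 := by
      ext j
      rcases j with u | ⟨i, j⟩
      · simp [KB.phi, hpow]
      · simp [KB.phi, htriv j.1 j.2]
    exact DFunLike.congr_fun this w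
  let f : KB.L m {j : Fin r // j ≠ ⟨0, hr⟩} →* θ.ker := (KB.phi y ⟨0, hr⟩).codRestrict θ.ker hker
  have hf : Function.Bijective f := by
    constructor
    · intro a b h
      exact KB.phi_injective y _ (congrArg Subtype.val h)
    · rintro ⟨g, hg⟩
      obtain ⟨k, hk, w, rfl⟩ := KB.phi_range (m := m) y ⟨0, hr⟩ g
      have h1 : θ (y ⟨0, hr⟩) ^ k = 1 := by
        have h2 := MonoidHom.mem_ker.1 hg
        rw [map_mul, MonoidHom.mem_ker.1 (hker w)] at h2
        simpa using h2
      have h3 : k = 0 := by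
        have := orderOf_dvd_of_pow_eq_one h1
        rw [hord] at this
        exact Nat.eq_zero_of_dvd_of_lt this hk
      subst h3
      exact ⟨w, Subtype.ext (by simp [f])⟩
  refine ⟨FreeGroupBasis.ofRepr (MulEquiv.ofBijective f hf).symm, ?_, ?_⟩
  · change KB.phi y ⟨0, hr⟩ (FreeGroup.of _) = _
    simp [KB.phi]
  · intro i j
    change KB.phi y ⟨0, hr⟩ (FreeGroup.of _) = _
    simp [KB.phi]
end

section
/- Let n ≥ 2 be an integer. Let T ⊆ ℂ be the tripod T = { t·ζ : t ∈ [0,1], ζ ∈ {1, e^{2πi/3}, e^{4πi/3}} } with the subspace topology (a tree with one essential vertex, not homeomorphic to an interval). Let S = ℝ/ℤ be the circle with the free ℤₙ-action x ↦ x + k/n. Then there exists a continuous map g : S → T such that g(x + k/n) ≠ g(x) for all x ∈ S and all integers k with 1 ≤ k ≤ n − 1. (Instance of the paper's theorem that the Borsuk–Ulam property fails for the unique homotopy class of maps into any tree not homeomorphic to an interval.) -/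
noncomputable def tpM (t : ℝ) : ℝ := 2 * |t - round t|

lemma tpM_norm (t : ℝ) : tpM t = 2 * ‖(t : AddCircle (1 : ℝ))‖ := by
  rw [AddCircle.norm_eq]; simp [tpM]

lemma tpM_cont : Continuous tpM := by
  rw [funext tpM_norm]
  exact continuous_const.mul (continuous_norm.comp (AddCircle.continuous_mk' 1))

lemma tpM_add_int (t : ℝ) (k : ℤ) : tpM (t + k) = tpM t := by
  simp [tpM, round_add_intCast]

lemma tpM_int (k : ℤ) : tpM k = 0 := by simp [tpM]

lemma tpM_nonneg (t : ℝ) : 0 ≤ tpM t := by unfold tpM; positivity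

lemma tpM_le (t : ℝ) : tpM t ≤ 1 := by
  have := abs_sub_round t
  unfold tpM; linarith

lemma tpM_half (s : ℝ) (h : 1 / 2 ≤ s) (h1 : s < 1) : tpM s = 2 - 2 * s := by
  have hr : round s = 1 := by
    rw [round_eq, Int.floor_eq_iff]; push_cast; constructor <;> linarith
  unfold tpM
  rw [hr, abs_of_nonpos (by push_cast; linarith)]; push_cast; ring

/-- signed coordinate; here `m = n - 1` -/
noncomputable def tpU (m t : ℝ) : ℝ :=
  if t ≤ m then 1 - t / m - tpM t else max 0 (2 * (t - m) - 1)

noncomputable def tpB (m t : ℝ) : ℝ := max 0 ((t - m) * (1 - 2 * (t - m)))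

lemma tpB_of_le {m t : ℝ} (h : t ≤ m) : tpB m t = 0 := by
  unfold tpB; apply max_eq_left; nlinarith

lemma tpB_cont (m : ℝ) : Continuous (tpB m) := by unfold tpB; fun_prop

lemma tpU_cont (m : ℕ) (hm : 1 ≤ m) : Continuous (tpU m) := by
  have hm' : (m : ℝ) ≠ 0 := by positivity
  unfold tpU
  refine Continuous.if_le ?_ ?_ continuous_id continuous_const ?_
  · exact (continuous_const.sub (continuous_id.div_const _)).sub tpM_cont
  · fun_prop
  · rintro x rfl
    have := tpM_int m
    push_cast at this
    rw [this, div_self hm']; norm_num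

lemma tp_ne (m : ℕ) (hm : 1 ≤ m) (t : ℝ) (k : ℤ) (ht : 0 ≤ t) (hk : 1 ≤ k) (h : t + k < m + 1)
    (hu : tpU m t = tpU m (t + k)) (hb : tpB m t = tpB m (t + k)) : False := by
  have hm' : (0 : ℝ) < m := by positivity
  have hk' : (1 : ℝ) ≤ k := by exact_mod_cast hk
  have htm : t ≤ m := by linarith
  by_cases hc : t + k ≤ m
  · rw [tpU, tpU, if_pos htm, if_pos hc, tpM_add_int, add_div] at hu
    have : 0 < (k : ℝ) / m := by positivity
    linarith
  · rw [tpB_of_le htm, tpB] at hb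
    rw [tpU, tpU, if_pos htm, if_neg hc] at hu
    push Not at hc
    have hM : tpM t = tpM (t + k - m) := by
      rw [← tpM_add_int t (k - m)]; push_cast; congr 1; ring
    rw [hM] at hu
    rcases lt_or_ge (t + k - m) (1 / 2) with hs | hs
    · have h2 : 0 < (t + k - m) * (1 - 2 * (t + k - m)) := by
        apply mul_pos <;> linarith
      have := le_max_right 0 ((t + k - m) * (1 - 2 * (t + k - m)))
      linarith
    · rw [tpM_half _ hs (by linarith), max_eq_right (by linarith)] at hu
      have h0 : t / m = 0 := by linarith
      have h0 : t = 0 := by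
        rcases div_eq_zero_iff.1 h0 with h | h
        · exact h
        · exact absurd h hm'.ne'
      subst h0
      have h1 : (m : ℤ) < k := by
        have : ((m : ℤ) : ℝ) < k := by push_cast; linarith
        exact_mod_cast this
      have h2 : k < (m : ℤ) + 1 := by
        have : (k : ℝ) < (((m : ℤ) + 1 : ℤ) : ℝ) := by push_cast; linarith
        exact_mod_cast this
      omega

noncomputable def tpZ (u b : ℝ) : ℂ :=
  ((max u 0 : ℝ) : ℂ) + (b : ℝ) * Complex.exp (2 * Real.pi * Complex.I / 3) +
    ((max (-u) 0 : ℝ) : ℂ) * Complex.exp (4 * Real.pi * Complex.I / 3)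

lemma tp_w1 : Complex.exp (2 * Real.pi * Complex.I / 3) = ⟨-1/2, √3/2⟩ := by
  have : (2 * Real.pi * Complex.I / 3 : ℂ) = ((Real.pi - Real.pi / 3 : ℝ) : ℂ) * Complex.I := by
    push_cast; ring
  rw [this]
  apply Complex.ext
  · rw [Complex.exp_ofReal_mul_I_re, Real.cos_pi_sub, Real.cos_pi_div_three]; norm_num
  · rw [Complex.exp_ofReal_mul_I_im, Real.sin_pi_sub, Real.sin_pi_div_three]

lemma tp_w2 : Complex.exp (4 * Real.pi * Complex.I / 3) = ⟨-1/2, -(√3/2)⟩ := by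
  have : (4 * Real.pi * Complex.I / 3 : ℂ) = ((Real.pi / 3 + Real.pi : ℝ) : ℂ) * Complex.I := by
    push_cast; ring
  rw [this]
  apply Complex.ext
  · rw [Complex.exp_ofReal_mul_I_re, Real.cos_add_pi, Real.cos_pi_div_three]; norm_num
  · rw [Complex.exp_ofReal_mul_I_im, Real.sin_add_pi, Real.sin_pi_div_three]

lemma tpZ_inj {u b u' b' : ℝ} (h : tpZ u b = tpZ u' b') : u = u' ∧ b = b' := by
  unfold tpZ at h
  rw [tp_w1, tp_w2] at h
  have hre := congrArg Complex.re h
  have him := congrArg Complex.im h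
  simp only [Complex.add_re, Complex.add_im, Complex.mul_re, Complex.mul_im,
    Complex.ofReal_re, Complex.ofReal_im] at hre him
  have h3 : (0 : ℝ) < √3 := by positivity
  have him' : b - max (-u) 0 = b' - max (-u') 0 := by
    apply mul_left_cancel₀ h3.ne'
    linarith
  have e (v : ℝ) : max v 0 - max (-v) 0 = v := by
    rcases le_total v 0 with hv | hv
    · rw [max_eq_right hv, max_eq_left (by linarith)]; ring
    · rw [max_eq_left hv, max_eq_right (by linarith)]; ring
  have hu : u = u' := by
    have := e u
    have := e u'
    linarith
  subst hu
  exact ⟨rfl, by linarith⟩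

lemma tp_ranges (m : ℕ) (hm : 1 ≤ m) (t : ℝ) (ht : 0 ≤ t) (h : t ≤ m + 1) :
    (-1 ≤ tpU m t ∧ tpU m t ≤ 1) ∧ (0 ≤ tpB m t ∧ tpB m t ≤ 1) ∧
      (tpU m t = 0 ∨ tpB m t = 0) := by
  have hm' : (0 : ℝ) < m := by positivity
  rcases le_or_gt t m with hc | hc
  · rw [tpB_of_le hc, tpU, if_pos hc]
    have h1 := tpM_nonneg t
    have h2 := tpM_le t
    have h3 : 0 ≤ t / m := by positivity
    have h4 : t / m ≤ 1 := (div_le_one hm').2 hc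
    refine ⟨⟨by linarith, by linarith⟩, ⟨le_rfl, zero_le_one⟩, Or.inr rfl⟩
  · rw [tpU, if_neg (not_le.2 hc), tpB]
    refine ⟨⟨?_, ?_⟩, ⟨le_max_left _ _, ?_⟩, ?_⟩
    · exact le_trans (by norm_num) (le_max_left _ _)
    · exact max_le zero_le_one (by linarith)
    · exact max_le zero_le_one (by nlinarith)
    · rcases le_total (2 * (t - m) - 1) 0 with hs | hs
      · left; exact max_eq_left hs
      · right; apply max_eq_left; nlinarith

open Complex in
/-- Let `T ⊆ ℂ` be the tripod (a tree with one essential vertex, not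
homeomorphic to an interval) and let `S = ℝ/ℤ` carry the free `ℤₙ`-action by rotations
`x ↦ x + k/n` (`n ≥ 2`). Then there is a continuous map `g : S → T` with
`g (x + k/n) ≠ g x` for all `x` and all `1 ≤ k ≤ n - 1`, i.e., the Borsuk–Ulam property
fails for the unique homotopy class of maps `S → T`. -/
theorem borsukUlam_fails_for_circle_to_tripod
    (n : ℕ) (hn : 2 ≤ n)
    (T : Set ℂ)
    (hT : T = {z : ℂ | ∃ t : ℝ, t ∈ Set.Icc (0 : ℝ) 1 ∧ ∃ ζ : ℂ,
        (ζ = 1 ∨ ζ = Complex.exp (2 * Real.pi * Complex.I / 3) ∨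
          ζ = Complex.exp (4 * Real.pi * Complex.I / 3)) ∧ z = (t : ℝ) • ζ}) :
    ∃ g : C(AddCircle (1 : ℝ), T),
      ∀ (x : AddCircle (1 : ℝ)) (k : ℤ), 1 ≤ k → k ≤ (n : ℤ) - 1 →
        g (x + (((k : ℝ) / (n : ℝ) : ℝ) : AddCircle (1 : ℝ))) ≠ g x := by
  obtain ⟨m, rfl⟩ : ∃ m, n = m + 1 := ⟨n - 1, by omega⟩
  have hm : 1 ≤ m := by omega
  have hm' : (0 : ℝ) < m := by positivity
  have hn' : (0 : ℝ) < (m : ℝ) + 1 := by positivity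
  let f : ℝ → ℂ := fun x => tpZ (tpU m ((m + 1) * x)) (tpB m ((m + 1) * x))
  have hfc : Continuous f := by
    have h1 : Continuous fun x : ℝ => tpU m ((m + 1) * x) :=
      (tpU_cont m hm).comp (by fun_prop)
    have h2 : Continuous fun x : ℝ => tpB m ((m + 1) * x) :=
      (tpB_cont m).comp (by fun_prop)
    simp only [f, tpZ]
    fun_prop
  have hf01 : f 0 = f 1 := by
    have h0 : tpM 0 = 0 := by simpa using tpM_int 0
    have e1 : tpU m ((m + 1) * 0) = 1 := by
      rw [mul_zero, tpU, if_pos hm'.le, h0]; simp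
    have e2 : tpU m ((m + 1) * 1) = 1 := by
      rw [mul_one, tpU, if_neg (by linarith)]; norm_num
    have e3 : tpB m ((m + 1) * 0) = 0 := tpB_of_le (by simp)
    have e4 : tpB m ((m + 1) * 1) = 0 := by
      rw [mul_one, tpB]; norm_num
    simp only [f, e1, e2, e3, e4]
  have hmem : ∀ x ∈ Set.Ico (0 : ℝ) 1, f x ∈ T := by
    intro x hx
    obtain ⟨⟨h1, h2⟩, ⟨h3, h4⟩, h5⟩ := tp_ranges m hm ((m + 1) * x)
      (mul_nonneg hn'.le hx.1) (by nlinarith [hx.2])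
    rw [hT]
    simp only [f]
    generalize tpU m ((m + 1) * x) = u at *
    generalize tpB m ((m + 1) * x) = b at *
    rcases h5 with rfl | rfl
    · exact ⟨b, ⟨h3, h4⟩, _, Or.inr (Or.inl rfl), by simp [tpZ]⟩
    · rcases le_total u 0 with hu | hu
      · refine ⟨-u, ⟨by linarith, by linarith⟩, _, Or.inr (Or.inr rfl), ?_⟩
        rw [tpZ, max_eq_right hu, max_eq_left (by linarith)]; simp
      · refine ⟨u, ⟨hu, h2⟩, _, Or.inl rfl, ?_⟩
        rw [tpZ, max_eq_left hu, max_eq_right (by linarith)]; simp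
  haveI : Fact ((0 : ℝ) < 1) := ⟨zero_lt_one⟩
  have hrep : ∀ y : AddCircle (1 : ℝ), ∃ a ∈ Set.Ico (0 : ℝ) 1, (a : AddCircle (1 : ℝ)) = y := by
    intro y
    have := (AddCircle.coe_image_Ico_eq (1 : ℝ) 0).symm ▸ Set.mem_univ y
    obtain ⟨a, ha, h⟩ := this
    exact ⟨a, by simpa using ha, h⟩
  have hval : ∀ a ∈ Set.Ico (0 : ℝ) 1, AddCircle.liftIco 1 0 f (a : AddCircle (1 : ℝ)) = f a :=
    fun a ha => AddCircle.liftIco_zero_coe_apply ha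
  have hGc : Continuous (AddCircle.liftIco (1 : ℝ) 0 f) :=
    AddCircle.liftIco_zero_continuous hf01 hfc.continuousOn
  have hGm : ∀ y, AddCircle.liftIco (1 : ℝ) 0 f y ∈ T := by
    intro y
    obtain ⟨a, ha, rfl⟩ := hrep y
    rw [hval a ha]; exact hmem a ha
  refine ⟨⟨fun y => ⟨AddCircle.liftIco (1 : ℝ) 0 f y, hGm y⟩, hGc.subtype_mk _⟩, ?_⟩
  intro x k hk1 hk2 heq
  have heq' : AddCircle.liftIco (1 : ℝ) 0 f (x + (((k : ℝ) / ((m + 1 : ℕ) : ℝ) : ℝ) :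
      AddCircle (1 : ℝ))) = AddCircle.liftIco (1 : ℝ) 0 f x := congrArg Subtype.val heq
  obtain ⟨a, ha, rfl⟩ := hrep x
  rw [hval a ha, ← AddCircle.coe_add] at heq'
  push_cast at heq' hk2
  have hk1' : (1 : ℝ) ≤ k := by exact_mod_cast hk1
  have hk2' : (k : ℝ) ≤ m := by
    have : k ≤ (m : ℤ) := by omega
    exact_mod_cast this
  have hkp : 0 < (k : ℝ) / (m + 1) := by positivity
  have hkl : (k : ℝ) / (m + 1) < 1 := by rw [div_lt_one hn']; linarith
  have hmul : ((m : ℝ) + 1) * (k / (m + 1)) = k := by field_simp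
  have ha0 : 0 ≤ ((m : ℝ) + 1) * a := mul_nonneg hn'.le ha.1
  have ha1 : ((m : ℝ) + 1) * a < m + 1 := by nlinarith [ha.2]
  rcases lt_or_ge (a + (k : ℝ) / (m + 1)) 1 with hc | hc
  · rw [hval _ ⟨by linarith [ha.1], hc⟩] at heq'
    obtain ⟨hu, hb⟩ := tpZ_inj heq'
    rw [mul_add, hmul] at hu hb
    refine tp_ne m hm _ k ha0 hk1 ?_ hu.symm hb.symm
    have := mul_lt_mul_of_pos_left hc hn'
    rw [mul_add, hmul] at this
    linarith
  · have hcoe : ((a + (k : ℝ) / (m + 1) : ℝ) : AddCircle (1 : ℝ)) =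
        ((a + (k : ℝ) / (m + 1) - 1 : ℝ) : AddCircle (1 : ℝ)) := by
      rw [AddCircle.coe_sub, AddCircle.coe_period, sub_zero]
    rw [hcoe, hval _ ⟨by linarith, by linarith [ha.2]⟩] at heq'
    obtain ⟨hu, hb⟩ := tpZ_inj heq'
    have key : ((m : ℝ) + 1) * a =
        (m + 1) * (a + (k : ℝ) / (m + 1) - 1) + ((m + 1 - k : ℤ) : ℝ) := by
      rw [mul_sub, mul_add, hmul]; push_cast; ring
    refine tp_ne m hm ((m + 1) * (a + (k : ℝ) / (m + 1) - 1)) (m + 1 - k)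
      (mul_nonneg hn'.le (by linarith)) (by omega) ?_ ?_ ?_
    · rw [← key]; exact ha1
    · rw [← key]; exact hu
    · rw [← key]; exact hb
end

section
/- Let m ≥ 1 and let b be an integer with 1 ≤ b ≤ m. Let A ⊆ ℕ be the set A = {0, 1, …, b−2} ∪ {m−1} ∪ {m, m+1, …, 2m−b−1} (which has exactly m elements). Let ι : Fin m → ℕ be an injective map with range A, let r ∈ Fin m be the index with ι(r) = m−1, and let φ = Function.update ι r (2m−1) (so φ is injective with range {0,…,b−2} ∪ {m,…,2m−b−1} ∪ {2m−1}). Let σ_ι and σ_φ be the unique permutations of Fin m such that ι ∘ σ_ι⁻¹ and φ ∘ σ_φ⁻¹ are strictly increasing. Then, as functions, σ_ι = c ∘ σ_φ, where c is the cyclic permutation of Fin m (0-indexed ranks) fixing every i < b−1, sending i ↦ i+1 for b−1 ≤ i ≤ m−2, and sending m−1 ↦ b−1. -/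
/-- Let `1 ≤ b ≤ m` and let
`A = {0, …, b-2} ∪ {m-1} ∪ {m, …, 2m-b-1} ⊆ ℕ`. Let `ι : Fin m → ℕ` be injective with range
`A`, let `r` be the index with `ι r = m - 1`, and let `φ` be obtained from `ι` by replacing
the value `m - 1` by `2m - 1`. If `σι` and `σφ` are the sorting permutations of `ι` and `φ`
(i.e. `ι ∘ σι⁻¹` and `φ ∘ σφ⁻¹` are strictly increasing), then `σι = c ∘ σφ` where `c` is the
cyclic permutation of the (0-indexed) ranks fixing `i < b - 1`, sending `i ↦ i + 1` for
`b - 1 ≤ i ≤ m - 2`, and sending `m - 1 ↦ b - 1`. -/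
theorem associated_permutations_of_critical_edge
    (m b : ℕ) (hm : 1 ≤ m) (hb : 1 ≤ b) (hbm : b ≤ m)
    (ι : Fin m → ℕ) (hinj : Function.Injective ι)
    (hrange : Set.range ι =
      Set.Ico 0 (b - 1) ∪ {m - 1} ∪ Set.Ico m (2 * m - b))
    (r : Fin m) (hr : ι r = m - 1)
    (φ : Fin m → ℕ) (hφ : φ = Function.update ι r (2 * m - 1))
    (σι σφ : Equiv.Perm (Fin m))
    (hσι : StrictMono fun i => ι (σι.symm i))
    (hσφ : StrictMono fun i => φ (σφ.symm i))
    (c : Equiv.Perm (Fin m))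
    (hc : ∀ i : Fin m, (c i : ℕ) =
      if (i : ℕ) < b - 1 then (i : ℕ)
      else if (i : ℕ) = m - 1 then b - 1
      else (i : ℕ) + 1) :
    ∀ i : Fin m, σι i = c (σφ i) := by
  have hmem : ∀ x, (∃ i, ι i = x) ↔ (x < b - 1 ∨ x = m - 1 ∨ (m ≤ x ∧ x < 2 * m - b)) := by
    intro x
    have := Set.ext_iff.mp hrange x
    simp only [Set.mem_range, Set.mem_union, Set.mem_Ico, Set.mem_singleton_iff] at this
    rw [this]
    omega
  have hφr : φ r = 2 * m - 1 := by simp [hφ]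
  have hφn : ∀ i, i ≠ r → φ i = ι i := by
    intro i hi
    simp [hφ, hi]
  obtain ⟨f, hf⟩ : ∃ f : Fin m → ℕ, ∀ i, f i = if (i : ℕ) < b - 1 then (i : ℕ)
      else if (i : ℕ) = b - 1 then m - 1 else m + i - b := ⟨_, fun _ => rfl⟩
  obtain ⟨g, hg⟩ : ∃ g : Fin m → ℕ, ∀ i, g i = if (i : ℕ) < b - 1 then (i : ℕ)
      else if (i : ℕ) = m - 1 then 2 * m - 1 else m + i + 1 - b := ⟨_, fun _ => rfl⟩
  have hfm : StrictMono f := by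
    intro i j hij
    have h : (i : ℕ) < j := hij
    have := i.2
    have := j.2
    rw [hf, hf]
    split_ifs <;> omega
  have hgm : StrictMono g := by
    intro i j hij
    have h : (i : ℕ) < j := hij
    have := i.2
    have := j.2
    rw [hg, hg]
    split_ifs <;> omega
  have e1 : (fun i => ι (σι.symm i)) = f := by
    refine (StrictMono.range_inj hσι hfm).mp ?_
    ext x
    have h1 : x ∈ Set.range (fun i => ι (σι.symm i)) ↔ ∃ i, ι i = x :=
      ⟨fun ⟨i, hi⟩ => ⟨_, hi⟩, fun ⟨i, hi⟩ => ⟨σι i, by simpa using hi⟩⟩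
    rw [h1, hmem]
    clear h1
    constructor
    · rintro (h | h | h)
      · exact ⟨⟨x, by omega⟩, by rw [hf]; simp only; split_ifs <;> omega⟩
      · exact ⟨⟨b - 1, by omega⟩, by rw [hf]; simp only; split_ifs <;> omega⟩
      · exact ⟨⟨x + b - m, by omega⟩, by rw [hf]; simp only; split_ifs <;> omega⟩
    · rintro ⟨i, rfl⟩
      have := i.2
      rw [hf]
      split_ifs <;> omega
  have e2 : (fun i => φ (σφ.symm i)) = g := by
    refine (StrictMono.range_inj hσφ hgm).mp ?_
    ext x
    have h1 : x ∈ Set.range (fun i => φ (σφ.symm i)) ↔ ∃ i, φ i = x :=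
      ⟨fun ⟨i, hi⟩ => ⟨_, hi⟩, fun ⟨i, hi⟩ => ⟨σφ i, by simpa using hi⟩⟩
    have h2 : (∃ i, φ i = x) ↔ (x < b - 1 ∨ x = 2 * m - 1 ∨ (m ≤ x ∧ x < 2 * m - b)) := by
      constructor
      · rintro ⟨i, rfl⟩
        by_cases hi : i = r
        · subst hi
          omega
        · rw [hφn i hi]
          have h3 := (hmem (ι i)).mp ⟨i, rfl⟩
          have h4 : ι i ≠ m - 1 := fun h => hi (hinj (h.trans hr.symm))
          omega
      · intro h
        by_cases hx : x = 2 * m - 1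
        · exact ⟨r, by rw [hφr, hx]⟩
        · obtain ⟨i, hi⟩ := (hmem x).mpr (by omega)
          refine ⟨i, ?_⟩
          rw [hφn i, hi]
          rintro rfl
          omega
    rw [h1, h2]
    clear h1 h2
    constructor
    · rintro (h | h | h)
      · exact ⟨⟨x, by omega⟩, by rw [hg]; simp only; split_ifs <;> omega⟩
      · exact ⟨⟨m - 1, by omega⟩, by rw [hg]; simp only; split_ifs <;> omega⟩
      · exact ⟨⟨x + b - m - 1, by omega⟩, by rw [hg]; simp only; split_ifs <;> omega⟩
    · rintro ⟨i, rfl⟩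
      have := i.2
      rw [hg]
      split_ifs <;> omega
  intro i
  apply hfm.injective
  have a1 : ι i = f (σι i) := by simpa using congrFun e1 (σι i)
  have a2 : φ i = g (σφ i) := by simpa using congrFun e2 (σφ i)
  rw [← a1, hf, hc]
  rw [hg] at a2
  have := (σφ i).2
  by_cases hi : i = r
  · subst hi
    rw [hφr] at a2
    split_ifs at a2 ⊢ <;> omega
  · rw [hφn i hi] at a2
    have h3 := (hmem (ι i)).mp ⟨i, rfl⟩
    have h4 : ι i ≠ m - 1 := fun h => hi (hinj (h.trans hr.symm))
    split_ifs at a2 ⊢ <;> omega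
end
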